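/- In the setting of multiplier transfer, assuming additionally C = closure(span(M* M C)) (the TRO acts non-degenerately on C), the left multiplier algebra satisfies M_ℓ(X) = closure(span(M* M_ℓ(Y) M)), given the inclusions M* M_ℓ(Y) M ⊆ M_ℓ(X) and M M_ℓ(X) M* ⊆ M_ℓ(Y). -/

import Mathlib

open ContinuousLinearMap

noncomputable section

/-- Norm closure of the linear span of a set of operators. -/
def csp {E : Type*} [NormedAddCommGroup E] [NormedSpace ℂ E] (S : Set E) : Set E :=
  closure (Submodule.span ℂ S : Set E)

open Filter Topology in
/-- An element of a C⋆-algebra `B` that lies in the closed span of `B * S`, for a ⋆-subalgebra `S`,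
can be approximated by its own right multiples by elements of `S`. -/
theorem mem_closure_mul_left_image {B : Type*} [CStarAlgebra B]
    (S : NonUnitalStarSubalgebra ℂ B) {c : B}
    (hc : c ∈ csp {x : B | ∃ b, ∃ s ∈ S, x = b * s}) :
    c ∈ closure ((c * ·) '' (S : Set B)) := by
  let T := S.topologicalClosure
  have hT : IsClosed (T : Set B) := S.isClosed_topologicalClosure
  let _ : NonUnitalCStarAlgebra T := { toCompleteSpace := hT.completeSpace_coe }
  let _ : PartialOrder T := CStarAlgebra.spectralOrder T
  have : StarOrderedRing T := CStarAlgebra.spectralOrderedRing T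
  let l := CStarAlgebra.approximateUnit T
  have hl : l.IsIncreasingApproximateUnit := CStarAlgebra.increasingApproximateUnit T
  have : l.NeBot := hl.neBot
  have hspan : ∀ x ∈ Submodule.span ℂ {x : B | ∃ b, ∃ s ∈ S, x = b * s},
      Tendsto (fun e : T ↦ x * (e : B)) l (𝓝 x) := by
    intro x hx
    induction hx using Submodule.span_induction with
    | mem x hx =>
      obtain ⟨b, s, hs, rfl⟩ := hx
      have h := (continuous_subtype_val.tendsto _).comp
        (hl.tendsto_mul_left ⟨s, S.le_topologicalClosure hs⟩)
      simpa [mul_assoc, Function.comp_def] using h.const_mul b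
    | zero => simp
    | add x y _ _ hx hy => simpa [add_mul] using hx.add hy
    | smul a x _ hx => simpa using hx.const_smul a
  have htendsto : Tendsto (fun e : T ↦ c * (e : B)) l (𝓝 c) := by
    rw [Metric.tendsto_nhds]
    intro ε hε
    obtain ⟨x, hx, hcx⟩ := Metric.mem_closure_iff.mp hc (ε / 3) (by positivity)
    filter_upwards [Metric.tendsto_nhds.mp (hspan x hx) (ε / 3) (by positivity),
      hl.eventually_norm] with e he hnorm
    have hce : dist (c * (e : B)) (x * (e : B)) ≤ dist c x := by
      rw [dist_eq_norm, dist_eq_norm, ← sub_mul]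
      exact (norm_mul_le _ _).trans (mul_le_of_le_one_right (norm_nonneg _) hnorm)
    have h := dist_triangle4 (c * (e : B)) (x * (e : B)) x c
    rw [dist_comm x c] at h
    linarith
  have hmem : c ∈ closure ((c * ·) '' (T : Set B)) :=
    mem_closure_of_tendsto htendsto (.of_forall fun e ↦ ⟨e, e.2, rfl⟩)
  exact closure_minimal (image_closure_subset_closure_image (continuous_const_mul c))
    isClosed_closure hmem

theorem map_mem_csp {E F : Type*} [NormedAddCommGroup E] [NormedSpace ℂ E]
    [NormedAddCommGroup F] [NormedSpace ℂ F] (f : E →L[ℂ] F) {S : Set E} {T : Set F}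
    (hf : ∀ s ∈ S, f s ∈ csp T) {x : E} (hx : x ∈ csp S) : f x ∈ csp T := by
  have hspan : Submodule.span ℂ S ≤
      (Submodule.span ℂ T).topologicalClosure.comap f.toLinearMap :=
    Submodule.span_le.mpr hf
  exact closure_minimal hspan (isClosed_closure.preimage f.continuous) hx

theorem subset_csp {E : Type*} [NormedAddCommGroup E] [NormedSpace ℂ E] (S : Set E) :
    S ⊆ csp S :=
  Submodule.subset_span.trans subset_closure

section TRO

variable {H K : Type*}
  [NormedAddCommGroup H] [InnerProductSpace ℂ H] [CompleteSpace H]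
  [NormedAddCommGroup K] [InnerProductSpace ℂ K] [CompleteSpace K]

/-- The ⋆-algebra spanned by `M* M` for a ternary ring of operators `M`. -/
def rightStarSubalgebra (M : Submodule ℂ (H →L[ℂ] K))
    (hTRO : ∀ m ∈ M, ∀ n ∈ M, ∀ l ∈ M, m ∘L (adjoint n) ∘L l ∈ M) :
    NonUnitalStarSubalgebra ℂ (H →L[ℂ] H) where
  __ := Submodule.span ℂ {T : H →L[ℂ] H | ∃ m ∈ M, ∃ n ∈ M, T = adjoint m ∘L n}
  mul_mem' {a b} ha hb := by
    refine Submodule.span_le.mpr ?_ (Submodule.mul_mem_mul ha hb |> fun h ↦ by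
      rwa [Submodule.span_mul_span] at h)
    rintro _ ⟨_, ⟨m, hm, n, hn, rfl⟩, _, ⟨p, hp, q, hq, rfl⟩, rfl⟩
    exact Submodule.subset_span ⟨m, hm, _, hTRO n hn p hp q hq, rfl⟩
  star_mem' {a} ha := by
    change a ∈ Submodule.span ℂ _ at ha
    change star a ∈ Submodule.span ℂ _
    induction ha using Submodule.span_induction with
    | mem x hx =>
      obtain ⟨m, hm, n, hn, rfl⟩ := hx
      exact Submodule.subset_span ⟨n, hn, m, hm, by simp [star_eq_adjoint, adjoint_comp]⟩
    | zero => simp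
    | add x y _ _ hx hy => simpa using add_mem hx hy
    | smul r x _ hx => simpa using Submodule.smul_mem _ _ hx

end TRO

/-- In the multiplier-transfer setting, if additionally the TRO acts nondegenerately on
`M_ℓ(X)` (`c ∈ closure span (M* M c)` for every `c ∈ M_ℓ(X)`), `M_ℓ(X)` is norm closed,
and `M* M_ℓ(Y) M ⊆ M_ℓ(X)`, `M M_ℓ(X) M* ⊆ M_ℓ(Y)`, then
`M_ℓ(X) = closure span (M* M_ℓ(Y) M)`. -/
theorem stmt17 {H K : Type*}
    [NormedAddCommGroup H] [InnerProductSpace ℂ H] [CompleteSpace H]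
    [NormedAddCommGroup K] [InnerProductSpace ℂ K] [CompleteSpace K]
    (M : Submodule ℂ (H →L[ℂ] K)) (hMclosed : IsClosed (M : Set (H →L[ℂ] K)))
    (hTRO : ∀ m ∈ M, ∀ n ∈ M, ∀ l ∈ M, m ∘L (adjoint n) ∘L l ∈ M)
    (C : Submodule ℂ (H →L[ℂ] H)) (hCclosed : IsClosed (C : Set (H →L[ℂ] H)))
    (hCmul : ∀ a ∈ C, ∀ b ∈ C, a ∘L b ∈ C) (hCstar : ∀ a ∈ C, adjoint a ∈ C)
    (D : Submodule ℂ (K →L[ℂ] K)) (hDclosed : IsClosed (D : Set (K →L[ℂ] K)))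
    (hDmul : ∀ a ∈ D, ∀ b ∈ D, a ∘L b ∈ D) (hDstar : ∀ a ∈ D, adjoint a ∈ D)
    (X : Submodule ℂ (H →L[ℂ] H)) (hXclosed : IsClosed (X : Set (H →L[ℂ] H)))
    (hXC : X ≤ C)
    (Y : Submodule ℂ (K →L[ℂ] K)) (hYclosed : IsClosed (Y : Set (K →L[ℂ] K)))
    (hYD : Y ≤ D)
    (hX : (X : Set (H →L[ℂ] H)) =
      csp {T | ∃ m ∈ M, ∃ y ∈ Y, ∃ n ∈ M, T = (adjoint m) ∘L y ∘L n})
    (hY : (Y : Set (K →L[ℂ] K)) =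
      csp {T | ∃ m ∈ M, ∃ x ∈ X, ∃ n ∈ M, T = m ∘L x ∘L (adjoint n)})
    (hC : (C : Set (H →L[ℂ] H)) =
      csp {T | ∃ m ∈ M, ∃ d ∈ D, ∃ n ∈ M, T = (adjoint m) ∘L d ∘L n})
    (hD : (D : Set (K →L[ℂ] K)) =
      csp {T | ∃ m ∈ M, ∃ c ∈ C, ∃ n ∈ M, T = m ∘L c ∘L (adjoint n)})
    (MlX : Set (H →L[ℂ] H)) (hMlX : MlX = {a | a ∈ C ∧ ∀ x ∈ X, a ∘L x ∈ X})
    (MlY : Set (K →L[ℂ] K)) (hMlY : MlY = {b | b ∈ D ∧ ∀ y ∈ Y, b ∘L y ∈ Y})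
    (hsub₁ : ∀ m ∈ M, ∀ b ∈ MlY, ∀ n ∈ M, (adjoint m) ∘L b ∘L n ∈ MlX)
    (hsub₂ : ∀ m ∈ M, ∀ a ∈ MlX, ∀ n ∈ M, m ∘L a ∘L (adjoint n) ∈ MlY)
    (hMlXclosed : IsClosed MlX)
    (hnondeg : ∀ c ∈ MlX,
      c ∈ csp {T : H →L[ℂ] H | ∃ m ∈ M, ∃ n ∈ M, T = (adjoint m) ∘L n ∘L c}) :
    MlX = csp {T : H →L[ℂ] H | ∃ m ∈ M, ∃ b ∈ MlY, ∃ n ∈ M,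
      T = (adjoint m) ∘L b ∘L n} := by
  let S := rightStarSubalgebra M hTRO
  apply Set.Subset.antisymm
  · intro c hc
    have hcC : c ∈ (C : Set (H →L[ℂ] H)) := (hMlX ▸ hc : c ∈ {a | a ∈ C ∧ ∀ x ∈ X, a ∘L x ∈ X}).1
    have hcS : c ∈ csp {x : H →L[ℂ] H | ∃ b, ∃ s ∈ S, x = b * s} := by
      rw [hC] at hcC
      refine map_mem_csp (.id ℂ _) ?_ hcC
      rintro _ ⟨m, hm, d, hd, n, hn, rfl⟩
      have hd' : d ∈ (D : Set (K →L[ℂ] K)) := hd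
      rw [hD] at hd'
      refine map_mem_csp (compL ℂ H K H (adjoint m) ∘L (compL ℂ H K K).flip n) ?_ hd'
      rintro _ ⟨p, -, a, -, q, hq, rfl⟩
      exact subset_csp _ ⟨adjoint m ∘L p ∘L a, adjoint q ∘L n,
        Submodule.subset_span ⟨q, hq, n, hn, rfl⟩, rfl⟩
    refine closure_minimal ?_ isClosed_closure (mem_closure_mul_left_image S hcS)
    rintro _ ⟨s, hs, rfl⟩
    refine map_mem_csp (ContinuousLinearMap.mul ℂ (H →L[ℂ] H) c) ?_ (subset_closure hs)
    rintro _ ⟨m, hm, n, hn, rfl⟩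
    refine map_mem_csp ((ContinuousLinearMap.mul ℂ (H →L[ℂ] H)).flip (adjoint m ∘L n)) ?_
      (hnondeg c hc)
    rintro _ ⟨p, hp, q, hq, rfl⟩
    exact subset_csp _ ⟨p, hp, q ∘L c ∘L adjoint m, hsub₂ q hq c hc m hm, n, hn, rfl⟩
  · let N : Submodule ℂ (H →L[ℂ] H) :=
      { carrier := MlX
        zero_mem' := by
          rw [hMlX]
          exact ⟨C.zero_mem, fun x _ ↦ by simp⟩
        add_mem' := by
          rw [hMlX]
          exact fun ha hb ↦ ⟨C.add_mem ha.1 hb.1, fun x hx ↦ by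
            simpa [add_comp] using X.add_mem (ha.2 x hx) (hb.2 x hx)⟩
        smul_mem' := by
          rw [hMlX]
          exact fun r a ha ↦ ⟨C.smul_mem r ha.1, fun x hx ↦ by
            simpa [smul_comp] using X.smul_mem r (ha.2 x hx)⟩ }
    refine closure_minimal (Submodule.span_le (p := N).mpr ?_) hMlXclosed
    rintro _ ⟨m, hm, b, hb, n, hn, rfl⟩
    exact hsub₁ m hm b hb n hn
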